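/- (Consistency of TMA ε-meaningful contrasted regular boundaries.) Let N ≥ 1, K_c ≥ 1, K_s ≥ 1 and ε > 0. Suppose that on a probability space there are, for each i ∈ {1,…,N}, nonnegative real random variables U_{i,0},…,U_{i,K_c−1} (contrast p-values) and V_{i,0},…,V_{i,K_s−1} (regularity p-values) such that: (a) min_{k<K_c} U_{i,k} and min_{k'<K_s} V_{i,k'} are independent; (b) for every s ∈ [0,1], P(min_{k<K_c} U_{i,k} < s) ≤ K_c·s and P(min_{k'<K_s} V_{i,k'} < s) ≤ K_s·s. Define NFA_i = N·K_c·K_s · max( (min_{k<K_c} U_{i,k})², (min_{k'<K_s} V_{i,k'})² ). Then E[ #{ i : NFA_i < ε } ] ≤ ε. -/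

import Mathlib

open MeasureTheory ProbabilityTheory

/-- The minimum of a finite nonempty family of reals. -/
noncomputable def finMin {K : ℕ} (hK : 0 < K) (f : Fin K → ℝ) : ℝ :=
  Finset.univ.inf' (Finset.univ_nonempty_iff.mpr ⟨⟨0, hK⟩⟩) f

theorem finMin_measurable {Ω : Type*} [MeasurableSpace Ω] {K : ℕ} (hK : 0 < K)
    (f : Fin K → Ω → ℝ) (hf : ∀ k, Measurable (f k)) :
    Measurable (fun ω => finMin hK (fun k => f k ω)) := by
  refine measurable_of_Iio fun s => ?_
  have : (fun ω => finMin hK (fun k => f k ω)) ⁻¹' Set.Iio s = ⋃ k, {ω | f k ω < s} := by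
    ext ω
    simp [finMin, Finset.inf'_lt_iff]
  rw [this]
  exact MeasurableSet.iUnion fun k => measurableSet_lt (hf k) measurable_const

/-- Consistency of TMA ε-meaningful contrasted regular boundaries: for each
curve `i` there are nonnegative contrast p-values `U_{i,0},…,U_{i,K_c−1}` and
regularity p-values `V_{i,0},…,V_{i,K_s−1}` such that (a) `min_k U_{i,k}` and
`min_k' V_{i,k'}` are independent and (b) `P(min_k U_{i,k} < s) ≤ K_c·s` and
`P(min_k' V_{i,k'} < s) ≤ K_s·s` for every `s ∈ [0,1]`. With
`NFA_i = N·K_c·K_s · max((min_k U_{i,k})², (min_k' V_{i,k'})²)`, the expected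
number of indices `i` with `NFA_i < ε` is at most `ε`. -/
theorem tma_mcrb_consistency {Ω : Type*} [MeasurableSpace Ω]
    (P : Measure Ω) [IsProbabilityMeasure P]
    (N Kc Ks : ℕ) (hN : 0 < N) (hKc : 0 < Kc) (hKs : 0 < Ks)
    (ε : ℝ) (hε : 0 < ε)
    (U : Fin N → Fin Kc → Ω → ℝ) (V : Fin N → Fin Ks → Ω → ℝ)
    (hUmeas : ∀ i k, Measurable (U i k)) (hVmeas : ∀ i k, Measurable (V i k))
    (hUnn : ∀ i k ω, 0 ≤ U i k ω) (hVnn : ∀ i k ω, 0 ≤ V i k ω)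
    (hind : ∀ i, IndepFun (fun ω => finMin hKc (fun k => U i k ω))
                          (fun ω => finMin hKs (fun k => V i k ω)) P)
    (hUsup : ∀ i, ∀ s ∈ Set.Icc (0 : ℝ) 1,
      (P {ω | finMin hKc (fun k => U i k ω) < s}).toReal ≤ Kc * s)
    (hVsup : ∀ i, ∀ s ∈ Set.Icc (0 : ℝ) 1,
      (P {ω | finMin hKs (fun k => V i k ω) < s}).toReal ≤ Ks * s)
    (NFA : Fin N → Ω → ℝ)
    (hNFA : ∀ i ω, NFA i ω = (N : ℝ) * Kc * Ks *
      max (finMin hKc (fun k => U i k ω) ^ 2) (finMin hKs (fun k => V i k ω) ^ 2)) :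
    ∫ ω, (∑ i : Fin N,
      Set.indicator {ω' | NFA i ω' < ε} (fun _ => (1 : ℝ)) ω) ∂P ≤ ε := by
  have hNpos : (0 : ℝ) < N := by exact_mod_cast hN
  have hKc1 : (1 : ℝ) ≤ Kc := by exact_mod_cast hKc
  have hKs1 : (1 : ℝ) ≤ Ks := by exact_mod_cast hKs
  have hC : (0 : ℝ) < (N : ℝ) * Kc * Ks := by positivity
  obtain ⟨s, hs⟩ : ∃ s, s = Real.sqrt (ε / ((N : ℝ) * Kc * Ks)) := ⟨_, rfl⟩
  have hs0 : 0 ≤ s := hs ▸ Real.sqrt_nonneg _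
  have hs2 : s ^ 2 = ε / ((N : ℝ) * Kc * Ks) := by
    rw [hs, Real.sq_sqrt (by positivity)]
  have hs2' : (N : ℝ) * Kc * Ks * s ^ 2 = ε := by
    rw [hs2]; field_simp
  have hUm : ∀ i, Measurable (fun ω => finMin hKc (fun k => U i k ω)) := fun i =>
    finMin_measurable hKc _ (hUmeas i)
  have hVm : ∀ i, Measurable (fun ω => finMin hKs (fun k => V i k ω)) := fun i =>
    finMin_measurable hKs _ (hVmeas i)
  have hset : ∀ i, {ω' | NFA i ω' < ε} =
      {ω | finMin hKc (fun k => U i k ω) < s} ∩ {ω | finMin hKs (fun k => V i k ω) < s} := by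
    intro i
    ext ω
    have h1 : 0 ≤ finMin hKc (fun k => U i k ω) := Finset.le_inf' _ _ (fun k _ => hUnn i k ω)
    have h2 : 0 ≤ finMin hKs (fun k => V i k ω) := Finset.le_inf' _ _ (fun k _ => hVnn i k ω)
    simp only [Set.mem_setOf_eq, Set.mem_inter_iff, hNFA]
    rw [← hs2', mul_lt_mul_iff_right₀ hC, max_lt_iff, pow_lt_pow_iff_left₀ h1 hs0 two_ne_zero,
      pow_lt_pow_iff_left₀ h2 hs0 two_ne_zero]
  have hmeas : ∀ i, MeasurableSet {ω' | NFA i ω' < ε} := by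
    intro i
    rw [hset i]
    exact (measurableSet_lt (hUm i) measurable_const).inter
      (measurableSet_lt (hVm i) measurable_const)
  have hb : ∀ i, P.real {ω' | NFA i ω' < ε} ≤ ε / N := by
    intro i
    by_cases h1 : s ≤ 1
    · have hP := (hind i).measure_inter_preimage_eq_mul (Set.Iio s) (Set.Iio s)
        measurableSet_Iio measurableSet_Iio
      have hP' : P {ω' | NFA i ω' < ε} = P {ω | finMin hKc (fun k => U i k ω) < s} *
          P {ω | finMin hKs (fun k => V i k ω) < s} := by
        rw [hset i]; exact hP
      rw [Measure.real, hP', ENNReal.toReal_mul]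
      calc _ ≤ ((Kc : ℝ) * s) * (Ks * s) :=
            mul_le_mul (hUsup i s ⟨hs0, h1⟩) (hVsup i s ⟨hs0, h1⟩) ENNReal.toReal_nonneg
              (by positivity)
        _ = ε / N := by
            rw [← hs2']; field_simp
    · push Not at h1
      refine measureReal_le_one.trans ?_
      rw [le_div_iff₀ hNpos, one_mul, ← hs2']
      have a1 : (1 : ℝ) ≤ Kc * Ks := by nlinarith
      have a2 : (1 : ℝ) ≤ s ^ 2 := by nlinarith
      have a3 : (1 : ℝ) ≤ Kc * Ks * s ^ 2 := by nlinarith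
      nlinarith
  rw [integral_finset_sum _ (fun i _ => (integrable_const (1 : ℝ)).indicator (hmeas i))]
  calc _ ≤ ∑ i : Fin N, ε / N := by
        refine Finset.sum_le_sum fun i _ => ?_
        have h := integral_indicator_const (μ := P) (1 : ℝ) (hmeas i)
        rw [h]
        simpa using hb i
    _ = ε := by
        simp; field_simp
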